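/- Fix 0 < α < 1 and τ > 0. Let Λ ⊂ ℝⁿ be a nonempty closed set of Lebesgue measure zero and let f ∈ L_{2α}(ℝⁿ) be smooth and positive on ℝⁿ ∖ Λ with K⁻¹ d₀(y,Λ)^{−q} ≤ f(y) ≤ K d₀(y,Λ)^{−q} for all y ∈ ℝⁿ ∖ Λ, for some constants K > 0, q > 0; assume also f ∈ L^τ_loc(ℝⁿ). Let f_ε = f ∗ η_ε. Fix x ∈ ℝⁿ ∖ Λ, let δ₁ > 0 be such that f(y) > 10³ for every y with d₀(y,Λ) ≤ 10δ₁, and set δ₀ = 10⁻⁶ · min{d₀(x,Λ), δ₁}. Writing g_ε = (f_ε)^τ − f^τ, one has lim_{ε→0} ∫_{B_{δ₀}(0)} |g_ε(x+y) + g_ε(x−y) − 2g_ε(x)| / |y|^{n+2α} dy = 0. -/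

import Mathlib

open MeasureTheory Metric Set Filter

/-- The standard mollification `f_ε = f ∗ η_ε`, where `η_ε(x) = ε^{-n} η(x/ε)`. -/
noncomputable def mollify {n : ℕ} (η f : EuclideanSpace ℝ (Fin n) → ℝ) (ε : ℝ)
    (x : EuclideanSpace ℝ (Fin n)) : ℝ :=
  ∫ y : EuclideanSpace ℝ (Fin n), f (x - y) * ((ε ^ n)⁻¹ * η (ε⁻¹ • y))

open scoped Topology

/-- On a compact convex subset of an open set, a `C²` function is Lipschitz, with bounded
derivative, and its first-order Taylor expansion has a uniform quadratic remainder. -/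
theorem exists_lipschitz_and_taylor_bound {E : Type*} [NormedAddCommGroup E] [NormedSpace ℝ E]
    {h : E → ℝ} {U S : Set E} (hU : IsOpen U) (hh : ContDiffOn ℝ 2 h U) (hSU : S ⊆ U)
    (hS : IsCompact S) (hSc : Convex ℝ S) :
    ∃ L : ℝ, 0 ≤ L ∧ (∀ a ∈ S, ∀ b ∈ S, |h b - h a| ≤ L * ‖b - a‖) ∧
      (∀ a ∈ S, ‖fderiv ℝ h a‖ ≤ L) ∧
      ∀ a ∈ S, ∀ b ∈ S, |h b - h a - fderiv ℝ h a (b - a)| ≤ L * ‖b - a‖ ^ 2 := by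
  have hd : ContDiffOn ℝ 1 (fderiv ℝ h) U := hh.fderiv_of_isOpen hU (by norm_num)
  obtain ⟨K₁, hK₁⟩ := ((hh.of_le (by norm_num)).mono hSU).locallyLipschitzOn hSc
    |>.exists_lipschitzOnWith_of_compact hS
  obtain ⟨K₂, hK₂⟩ := (hd.mono hSU).locallyLipschitzOn hSc
    |>.exists_lipschitzOnWith_of_compact hS
  obtain ⟨B, hB⟩ := hS.exists_bound_of_continuousOn (hd.continuousOn.mono hSU)
  have hdiff : ∀ a ∈ S, HasFDerivAt h (fderiv ℝ h a) a := fun a ha =>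
    ((hh.contDiffAt (hU.mem_nhds (hSU ha))).differentiableAt (by norm_num)).hasFDerivAt
  refine ⟨max (max K₁ K₂) B, le_max_of_le_left (le_max_of_le_left K₁.2), fun a ha b hb => ?_,
    fun a ha => (hB a ha).trans (le_max_right _ _), fun a ha b hb => ?_⟩
  · have := hK₁.dist_le_mul b hb a ha
    rw [Real.dist_eq, dist_eq_norm] at this
    exact this.trans (by gcongr; exact le_max_of_le_left (le_max_left _ _))
  · have hseg : segment ℝ a b ⊆ S := hSc.segment_subset ha hb
    have := Convex.norm_image_sub_le_of_norm_hasFDerivWithin_le' (f := h) (s := segment ℝ a b)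
      (φ := fderiv ℝ h a) (C := K₂ * ‖b - a‖)
      (fun z hz => (hdiff z (hseg hz)).hasFDerivWithinAt) (fun z hz => ?_)
      (convex_segment a b) (left_mem_segment ℝ a b) (right_mem_segment ℝ a b)
    · rw [Real.norm_eq_abs] at this
      refine this.trans ?_
      rw [mul_assoc, ← sq]
      gcongr
      exact le_max_of_le_left (le_max_right _ _)
    · have h1 := hK₂.dist_le_mul z (hseg hz) a ha
      rw [dist_eq_norm, dist_eq_norm] at h1
      refine h1.trans ?_
      gcongr
      exact norm_sub_le_of_mem_segment hz

/-- Second differences of a real function with Lipschitz constant and quadratic Taylor remainder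
bounded by `L` are controlled by the second and first differences of the arguments. -/
theorem abs_second_difference_comp_le {φ : ℝ → ℝ} {S : Set ℝ} {L : ℝ}
    (hd : ∀ a ∈ S, ‖fderiv ℝ φ a‖ ≤ L)
    (ht : ∀ a ∈ S, ∀ b ∈ S, |φ b - φ a - fderiv ℝ φ a (b - a)| ≤ L * ‖b - a‖ ^ 2)
    {a b c : ℝ} (ha : a ∈ S) (hb : b ∈ S) (hc : c ∈ S) :
    |φ a + φ b - 2 * φ c| ≤ L * (|a + b - 2 * c| + (a - c) ^ 2 + (b - c) ^ 2) := by
  have h1 := ht c hc a ha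
  have h2 := ht c hc b hb
  have h3 : |fderiv ℝ φ c (a + b - 2 * c)| ≤ L * |a + b - 2 * c| :=
    ((fderiv ℝ φ c).le_opNorm _).trans (mul_le_mul_of_nonneg_right (hd c hc) (abs_nonneg _))
  have h4 : fderiv ℝ φ c (a + b - 2 * c) = fderiv ℝ φ c (a - c) + fderiv ℝ φ c (b - c) := by
    rw [← map_add]; congr 1; ring
  rw [Real.norm_eq_abs, sq_abs] at h1 h2
  rw [h4] at h3
  rw [abs_le] at *
  constructor <;> linarith [h1.1, h1.2, h2.1, h2.2, h3.1, h3.2]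

/-- After rescaling, mollification is an average of translates. -/
theorem mollify_eq_integral_smul {n : ℕ} (η f : EuclideanSpace ℝ (Fin n) → ℝ) {ε : ℝ} (hε : 0 < ε)
    (z : EuclideanSpace ℝ (Fin n)) : mollify η f ε z = ∫ u, f (z - ε • u) * η u := by
  have h := Measure.integral_comp_inv_smul_of_nonneg volume
    (fun u : EuclideanSpace ℝ (Fin n) => f (z - ε • u) * η u) hε.le
  simp only [smul_inv_smul₀ hε.ne', finrank_euclideanSpace_fin, smul_eq_mul] at h
  have hp : ε ^ n ≠ 0 := (pow_pos hε n).ne'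
  unfold mollify
  rw [← mul_right_inj' hp, ← h, ← integral_const_mul]
  refine integral_congr_ae (Eventually.of_forall fun y => ?_)
  field_simp

theorem measurable_mollify {n : ℕ} {η f : EuclideanSpace ℝ (Fin n) → ℝ} (hη : Measurable η)
    (hf : Measurable f) (ε : ℝ) : Measurable (mollify η f ε) := by
  have : StronglyMeasurable (Function.uncurry
      fun z y : EuclideanSpace ℝ (Fin n) => f (z - y) * ((ε ^ n)⁻¹ * η (ε⁻¹ • y))) :=
    Measurable.stronglyMeasurable (by unfold Function.uncurry; fun_prop)
  exact this.integral_prod_right.measurable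

/-- An average against a density supported in the unit ball is bounded by any bound on that ball. -/
theorem abs_integral_mul_le {E : Type*} [NormedAddCommGroup E] [MeasurableSpace E] {μ : Measure E}
    {η G : E → ℝ} (hηs : tsupport η ⊆ ball 0 1) (hηnn : ∀ x, 0 ≤ η x) (hηint : ∫ x, η x ∂μ = 1)
    {c : ℝ} (hG : ∀ u, ‖u‖ < 1 → |G u| ≤ c) : |∫ u, G u * η u ∂μ| ≤ c := by
  have hi : Integrable η μ := by
    by_contra h
    simp [integral_undef h] at hηint
  have := norm_integral_le_of_norm_le (μ := μ) (f := fun u => G u * η u) (hi.const_mul c)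
    (Eventually.of_forall fun u => ?_)
  · rwa [integral_const_mul, hηint, mul_one] at this
  · rw [norm_mul, Real.norm_eq_abs, Real.norm_of_nonneg (hηnn u)]
    by_cases hu : ‖u‖ < 1
    · exact mul_le_mul_of_nonneg_right (hG u hu) (hηnn u)
    · have : η u = 0 := by
        by_contra h
        exact hu (by simpa using hηs (subset_tsupport η h))
      simp [this]

theorem lintegral_ball_sq_div_rpow_ne_top {n : ℕ} (hn : 1 ≤ n) {s : ℝ} (hs : s < n + 2) (C r : ℝ) :
    ∫⁻ y in ball (0 : EuclideanSpace ℝ (Fin n)) r,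
      ENNReal.ofReal (C * ‖y‖ ^ 2 / ‖y‖ ^ s) ≠ ⊤ := by
  have hi : IntegrableOn (fun y : EuclideanSpace ℝ (Fin n) => C * ‖y‖ ^ 2 / ‖y‖ ^ s)
      (ball 0 r) volume := by
    refine integrableOn_ball_of_norm_le_rpow (C := |C|) (α := s - 2) (by simpa using hn)
      (by rw [finrank_euclideanSpace_fin]; linarith) (Eventually.of_forall fun y => ?_)
      (Measurable.aestronglyMeasurable (by fun_prop))
    rcases (norm_nonneg y).eq_or_lt with h | h
    · rw [← h]
      simp only [ne_eq, OfNat.ofNat_ne_zero, not_false_eq_true, zero_pow, mul_zero, zero_div,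
        norm_zero]
      positivity
    · rw [neg_sub, Real.rpow_sub h, norm_div, norm_mul, Real.norm_eq_abs C,
        Real.norm_of_nonneg (by positivity : 0 ≤ ‖y‖ ^ 2),
        Real.norm_of_nonneg (by positivity : 0 ≤ ‖y‖ ^ s), Real.rpow_two, mul_div_assoc]
  exact hi.lintegral_lt_top.ne

/-- Writing `g_ε = f_ε^τ - f^τ`, the weighted second-difference integral of `g_ε` over the
small ball `B_{δ₀}(0)` tends to `0` as `ε → 0⁺`, where
`δ₀ = 10⁻⁶ min{d₀(x,Λ), δ₁}`. -/
theorem stmt_12 (n : ℕ) (α τ : ℝ) (hα : α ∈ Set.Ioo (0 : ℝ) 1) (hτ : 0 < τ)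
    (Λ : Set (EuclideanSpace ℝ (Fin n))) (hΛne : Λ.Nonempty) (hΛc : IsClosed Λ)
    (hΛ0 : volume Λ = 0)
    (η : EuclideanSpace ℝ (Fin n) → ℝ) (hη : ContDiff ℝ (⊤ : ℕ∞) η)
    (hηs : tsupport η ⊆ ball (0 : EuclideanSpace ℝ (Fin n)) 1)
    (hηnn : ∀ x, 0 ≤ η x) (hηint : (∫ x, η x) = 1)
    (f : EuclideanSpace ℝ (Fin n) → ℝ) (hmeas : Measurable f)
    (hfL : Integrable (fun x => |f x| / (1 + ‖x‖ ^ ((n : ℝ) + 2 * α))) volume)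
    (hfs : ContDiffOn ℝ (⊤ : ℕ∞) f Λᶜ) (hfpos : ∀ y ∉ Λ, 0 < f y)
    (K q : ℝ) (hK : 0 < K) (hq : 0 < q)
    (hbound : ∀ y ∉ Λ,
      K⁻¹ * Metric.infDist y Λ ^ (-q) ≤ f y ∧ f y ≤ K * Metric.infDist y Λ ^ (-q))
    (hloc : ∀ s : Set (EuclideanSpace ℝ (Fin n)), IsCompact s →
      IntegrableOn (fun y => |f y| ^ τ) s volume)
    (x : EuclideanSpace ℝ (Fin n)) (hx : x ∉ Λ)
    (δ₁ : ℝ) (hδ₁ : 0 < δ₁)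
    (hδ₁' : ∀ y, Metric.infDist y Λ ≤ 10 * δ₁ → (10 : ℝ) ^ 3 < f y) :
    Tendsto (fun ε : ℝ =>
        ∫⁻ y in ball (0 : EuclideanSpace ℝ (Fin n))
            (((10 : ℝ) ^ 6)⁻¹ * min (Metric.infDist x Λ) δ₁),
          ENNReal.ofReal
            (|(mollify η f ε (x + y) ^ τ - f (x + y) ^ τ) +
                (mollify η f ε (x - y) ^ τ - f (x - y) ^ τ) -
                2 * (mollify η f ε x ^ τ - f x ^ τ)| / ‖y‖ ^ ((n : ℝ) + 2 * α)))
      (nhdsWithin 0 (Set.Ioi 0)) (nhds 0) := by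
  obtain ⟨hα0, hα1⟩ := hα
  have hn : 1 ≤ n := by
    rcases Nat.eq_zero_or_pos n with rfl | h
    · obtain ⟨p, hp⟩ := hΛne
      exact absurd (Subsingleton.elim p x ▸ hp) hx
    · exact h
  set d := infDist x Λ with hd
  have hd0 : 0 < d := (hΛc.notMem_iff_infDist_pos hΛne).1 hx
  set δ := ((10 : ℝ) ^ 6)⁻¹ * min d δ₁ with hδ
  have hδ0 : 0 < δ := by positivity
  have hδd : 4 * δ ≤ d := by
    have := min_le_left d δ₁
    norm_num at hδ
    linarith
  have hSU : closedBall x (d / 2) ⊆ Λᶜ := fun p hp hpΛ => by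
    have h1 := infDist_le_dist_of_mem (x := x) hpΛ
    rw [mem_closedBall, dist_comm] at hp
    linarith
  have hxS : x ∈ closedBall x (d / 2) := mem_closedBall_self (by linarith)
  have hScomp : IsCompact (closedBall x (d / 2)) := isCompact_closedBall x _
  obtain ⟨L, hL0, hLip, -, hTay⟩ := exists_lipschitz_and_taylor_bound hΛc.isOpen_compl
    (hfs.of_le (WithTop.coe_le_coe.2 le_top)) hSU hScomp (convex_closedBall x _)
  have hfc : ContinuousOn f (closedBall x (d / 2)) := hfs.continuousOn.mono hSU
  obtain ⟨p₀, hp₀, hmin⟩ := hScomp.exists_isMinOn ⟨x, hxS⟩ hfc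
  obtain ⟨p₁, hp₁, hmax⟩ := hScomp.exists_isMaxOn ⟨x, hxS⟩ hfc
  have hm0 : 0 < f p₀ := hfpos _ (hSU hp₀)
  have hfmem : ∀ z ∈ closedBall x (d / 2), f z ∈ Icc (f p₀) (f p₁) := fun z hz =>
    ⟨hmin hz, hmax hz⟩
  obtain ⟨P, hP0, -, hPd, hPt⟩ := exists_lipschitz_and_taylor_bound
    (h := fun t : ℝ => t ^ τ) (U := Ioi 0) (S := Icc (f p₀) (f p₁)) isOpen_Ioi
    (fun t ht => (Real.contDiffAt_rpow_const_of_ne (ne_of_gt ht)).contDiffWithinAt)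
    (fun t ht => hm0.trans_le ht.1) isCompact_Icc (convex_Icc _ _)
  have hη_int : Integrable η := by
    by_contra h
    simp [integral_undef h] at hηint
  have hS : ∀ y : EuclideanSpace ℝ (Fin n), ‖y‖ < δ → ∀ ε ∈ Ioo 0 δ,
      ∀ u : EuclideanSpace ℝ (Fin n), ‖u‖ < 1 → x + y - ε • u ∈ closedBall x (d / 2) := by
    intro y hy ε hε u hu
    rw [mem_closedBall, dist_eq_norm, show x + y - ε • u - x = y - ε • u by abel]
    have h1 := norm_sub_le y (ε • u)
    rw [norm_smul, Real.norm_of_nonneg hε.1.le] at h1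
    have h2 : ε * ‖u‖ ≤ ε := mul_le_of_le_one_right hε.1.le hu.le
    linarith [hε.2]
  have hS₀ : ∀ y : EuclideanSpace ℝ (Fin n), ‖y‖ < δ → x + y ∈ closedBall x (d / 2) := by
    intro y hy
    simpa using hS y hy (δ / 2) ⟨by linarith, by linarith⟩ 0 (by simp)
  have hηz : ∀ u, ¬ ‖u‖ < 1 → η u = 0 := fun u hu => by
    by_contra h
    exact hu (by simpa using hηs (subset_tsupport η h))
  have hInt : ∀ y : EuclideanSpace ℝ (Fin n), ‖y‖ < δ → ∀ ε ∈ Ioo 0 δ,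
      Integrable (fun u => f (x + y - ε • u) * η u) := by
    intro y hy ε hε
    refine (hη_int.const_mul (f p₁)).mono' (Measurable.aestronglyMeasurable (by
      have := hη.continuous.measurable
      fun_prop)) (Eventually.of_forall fun u => ?_)
    by_cases hu : ‖u‖ < 1
    · have h1 := hfmem _ (hS y hy ε hε u hu)
      rw [norm_mul, Real.norm_of_nonneg (hηnn u), Real.norm_of_nonneg (hm0.le.trans h1.1)]
      exact mul_le_mul_of_nonneg_right h1.2 (hηnn u)
    · simp [hηz u hu]
  have hconst : ∀ c : ℝ, c = ∫ u, c * η u := fun c => by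
    rw [integral_const_mul, hηint, mul_one]
  have hmem : ∀ y : EuclideanSpace ℝ (Fin n), ‖y‖ < δ → ∀ ε ∈ Ioo 0 δ,
      mollify η f ε (x + y) ∈ Icc (f p₀) (f p₁) := by
    intro y hy ε hε
    rw [mollify_eq_integral_smul η f hε.1]
    constructor
    · rw [hconst (f p₀)]
      refine integral_mono (hη_int.const_mul _) (hInt y hy ε hε) fun u => ?_
      by_cases hu : ‖u‖ < 1
      · exact mul_le_mul_of_nonneg_right (hfmem _ (hS y hy ε hε u hu)).1 (hηnn u)
      · simp [hηz u hu]
    · rw [hconst (f p₁)]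
      refine integral_mono (hInt y hy ε hε) (hη_int.const_mul _) fun u => ?_
      by_cases hu : ‖u‖ < 1
      · exact mul_le_mul_of_nonneg_right (hfmem _ (hS y hy ε hε u hu)).2 (hηnn u)
      · simp [hηz u hu]
  have happrox : ∀ y : EuclideanSpace ℝ (Fin n), ‖y‖ < δ → ∀ ε ∈ Ioo 0 δ,
      |mollify η f ε (x + y) - f (x + y)| ≤ L * ε := by
    intro y hy ε hε
    rw [mollify_eq_integral_smul η f hε.1]
    have h1 : (∫ u, f (x + y - ε • u) * η u) - f (x + y)
        = ∫ u, (f (x + y - ε • u) - f (x + y)) * η u := by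
      simp_rw [sub_mul]
      rw [integral_sub (hInt y hy ε hε) (hη_int.const_mul _), ← hconst]
    rw [h1]
    refine abs_integral_mul_le hηs hηnn hηint fun u hu => ?_
    refine (hLip _ (hS₀ y hy) _ (hS y hy ε hε u hu)).trans ?_
    rw [sub_sub_cancel_left, norm_neg, norm_smul, Real.norm_of_nonneg hε.1.le]
    have h2 : ε * ‖u‖ ≤ ε := mul_le_of_le_one_right hε.1.le hu.le
    gcongr
  have hfirst : ∀ y : EuclideanSpace ℝ (Fin n), ‖y‖ < δ → ∀ ε ∈ Ioo 0 δ,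
      |mollify η f ε (x + y) - mollify η f ε x| ≤ L * ‖y‖ := by
    intro y hy ε hε
    have h0 := hInt 0 (by simpa using hδ0) ε hε
    have hS0 := hS 0 (by simpa using hδ0) ε hε
    simp only [add_zero] at h0 hS0
    simp only [mollify_eq_integral_smul η f hε.1]
    rw [← integral_sub (hInt y hy ε hε) h0]
    simp_rw [← sub_mul]
    refine abs_integral_mul_le hηs hηnn hηint fun u hu => ?_
    refine (hLip _ (hS0 u hu) _ (hS y hy ε hε u hu)).trans_eq ?_
    congr 2
    abel
  have hf2 : ∀ z ∈ closedBall x (d / 2), ∀ y, z + y ∈ closedBall x (d / 2) →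
      z - y ∈ closedBall x (d / 2) → |f (z + y) + f (z - y) - 2 * f z| ≤ 2 * L * ‖y‖ ^ 2 := by
    intro z hz y hy1 hy2
    have h1 := hTay z hz _ hy1
    have h2 := hTay z hz _ hy2
    rw [add_sub_cancel_left] at h1
    rw [sub_sub_cancel_left, map_neg, norm_neg] at h2
    rw [abs_le] at *
    constructor <;> linarith [h1.1, h1.2, h2.1, h2.2]
  have hsecond : ∀ y : EuclideanSpace ℝ (Fin n), ‖y‖ < δ → ∀ ε ∈ Ioo 0 δ,
      |mollify η f ε (x + y) + mollify η f ε (x - y) - 2 * mollify η f ε x|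
        ≤ 2 * L * ‖y‖ ^ 2 := by
    intro y hy ε hε
    have hy' : ‖-y‖ < δ := by rwa [norm_neg]
    have h0 := hInt 0 (by simpa using hδ0) ε hε
    have hS0 := hS 0 (by simpa using hδ0) ε hε
    have h1 := hInt (-y) hy' ε hε
    have hS1 := hS (-y) hy' ε hε
    simp only [add_zero, ← sub_eq_add_neg] at h0 hS0 h1 hS1
    simp only [mollify_eq_integral_smul η f hε.1]
    have h12 : Integrable fun u => f (x + y - ε • u) * η u + f (x - y - ε • u) * η u :=
      (hInt y hy ε hε).add h1
    have h2 : (∫ u, f (x + y - ε • u) * η u) + (∫ u, f (x - y - ε • u) * η u)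
        - 2 * (∫ u, f (x - ε • u) * η u)
        = ∫ u, (f (x + y - ε • u) + f (x - y - ε • u) - 2 * f (x - ε • u)) * η u := by
      rw [← integral_add (hInt y hy ε hε) h1, ← integral_const_mul,
        ← integral_sub h12 (h0.const_mul 2)]
      congr 1
      ext u
      ring
    rw [h2]
    refine abs_integral_mul_le hηs hηnn hηint fun u hu => ?_
    have e1 : x + y - ε • u = x - ε • u + y := by abel
    have e2 : x - y - ε • u = x - ε • u - y := by abel
    have m1 := hS y hy ε hε u hu
    have m2 := hS1 u hu
    rw [e1] at m1 ⊢
    rw [e2] at m2 ⊢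
    exact hf2 _ (hS0 u hu) y m1 m2
  have hcomp : ∀ r : ℝ, ∀ a ∈ Icc (f p₀) (f p₁), ∀ b ∈ Icc (f p₀) (f p₁),
      ∀ c ∈ Icc (f p₀) (f p₁), |a + b - 2 * c| ≤ 2 * L * r ^ 2 → |a - c| ≤ L * r →
      |b - c| ≤ L * r → |a ^ τ + b ^ τ - 2 * c ^ τ| ≤ P * (2 * L + 2 * L ^ 2) * r ^ 2 := by
    intro r a ha b hb c hc h2 h3 h4
    refine (abs_second_difference_comp_le hPd hPt ha hb hc).trans ?_
    rw [mul_assoc]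
    refine mul_le_mul_of_nonneg_left ?_ hP0
    have h5 := sq_le_sq' (abs_le.1 h3).1 (abs_le.1 h3).2
    have h6 := sq_le_sq' (abs_le.1 h4).1 (abs_le.1 h4).2
    nlinarith
  have hev : ∀ᶠ ε in 𝓝[>] (0 : ℝ), ε ∈ Ioo 0 δ := Ioo_mem_nhdsGT hδ0
  have hlim : ∀ y : EuclideanSpace ℝ (Fin n), ‖y‖ < δ →
      Tendsto (fun ε => mollify η f ε (x + y) ^ τ - f (x + y) ^ τ) (𝓝[>] 0) (𝓝 0) := by
    intro y hy
    have h1 : Tendsto (fun ε => mollify η f ε (x + y)) (𝓝[>] 0) (𝓝 (f (x + y))) := by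
      rw [tendsto_iff_dist_tendsto_zero]
      refine squeeze_zero' (Eventually.of_forall fun _ => dist_nonneg)
        (hev.mono fun ε hε => happrox y hy ε hε) ?_
      exact ((continuous_const.mul continuous_id).tendsto' 0 0 (by simp)).mono_left
        nhdsWithin_le_nhds
    have h2 := (h1.rpow_const (p := τ) (Or.inr hτ.le)).sub_const (f (x + y) ^ τ)
    rwa [sub_self] at h2
  have hlimx := hlim 0 (by simpa using hδ0)
  simp only [add_zero] at hlimx
  rw [show (0 : ENNReal) = ∫⁻ _ in ball (0 : EuclideanSpace ℝ (Fin n)) δ, 0 by simp]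
  refine tendsto_lintegral_filter_of_dominated_convergence
    (fun y => ENNReal.ofReal
      (2 * (P * (2 * L + 2 * L ^ 2)) * ‖y‖ ^ 2 / ‖y‖ ^ ((n : ℝ) + 2 * α)))
    (Eventually.of_forall fun ε => ?_) ?_
    (lintegral_ball_sq_div_rpow_ne_top hn (by linarith) _ _) ?_
  · have := measurable_mollify hη.continuous.measurable hmeas ε
    fun_prop
  · filter_upwards [hev] with ε hε
    filter_upwards [ae_restrict_mem measurableSet_ball] with y hy
    rw [mem_ball_zero_iff] at hy
    have hy' : ‖-y‖ < δ := by rwa [norm_neg]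
    have hx0 := hmem 0 (by simpa using hδ0) ε hε
    have hm1 := hmem (-y) hy' ε hε
    have hf1 := hfirst (-y) hy' ε hε
    have hy1 := hS₀ (-y) hy'
    rw [norm_neg] at hf1
    simp only [add_zero, ← sub_eq_add_neg] at hx0 hm1 hf1 hy1
    have h1 := hcomp ‖y‖ _ (hmem y hy ε hε) _ hm1 _ hx0 (hsecond y hy ε hε)
      (hfirst y hy ε hε) hf1
    have h2 := hcomp ‖y‖ _ (hfmem _ (hS₀ y hy)) _ (hfmem _ hy1) _ (hfmem _ hxS)
      (hf2 x hxS y (hS₀ y hy) hy1) (by simpa using hLip _ hxS _ (hS₀ y hy))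
      (by simpa using hLip _ hxS _ hy1)
    refine ENNReal.ofReal_le_ofReal ?_
    gcongr
    rw [abs_le] at *
    constructor <;> linarith [h1.1, h1.2, h2.1, h2.2]
  · filter_upwards [ae_restrict_mem measurableSet_ball] with y hy
    rw [mem_ball_zero_iff] at hy
    have h1 := hlim (-y) (by rwa [norm_neg])
    simp only [← sub_eq_add_neg] at h1
    have h2 := (((((hlim y hy).add h1).sub (hlimx.const_mul 2)).abs).div_const
      (‖y‖ ^ ((n : ℝ) + 2 * α)))
    simpa using ENNReal.tendsto_ofReal h2
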